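/- Fix β ∈ (0,1) and ε > 0, let s_ε(ρ) = β ∫₀^ρ (x²+ε)^{(β−1)/2} dx, and define a_ε(ρ) = β²ρ²/((ρ²+ε)^{1−β} s_ε(ρ)²) for ρ > 0. Then β² < a_ε(ρ) ≤ 1 for every ρ > 0. Consequently, in the canonical polar coordinates the perturbed cone metric β²(|z|²+ε)^{β−1}|dz|² = ds² + a_ε²s²dθ² is uniformly (independently of ε) quasi-isometric to the Euclidean metric: β²(ds² + s²dθ²) < ds² + a_ε²s²dθ² ≤ ds² + s²dθ². -/

import Mathlib

open intervalIntegral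

/-- The radial arclength coordinate `s_ε(ρ) = β ∫₀^ρ (x²+ε)^{(β−1)/2} dx` of the
perturbed cone metric `β²(|z|²+ε)^{β−1}|dz|²` (real powers). -/
noncomputable def sGP (β ε ρ : ℝ) : ℝ :=
  β * ∫ x in (0:ℝ)..ρ, (x ^ 2 + ε) ^ ((β - 1) / 2)

/-- The angular coefficient `a_ε(ρ) = β²ρ²/((ρ²+ε)^{1−β} s_ε(ρ)²)` of the perturbed
cone metric in canonical polar coordinates. -/
noncomputable def aGP (β ε ρ : ℝ) : ℝ :=
  β ^ 2 * ρ ^ 2 / ((ρ ^ 2 + ε) ^ (1 - β) * (sGP β ε ρ) ^ 2)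

theorem continuous_sq_add_rpow {ε : ℝ} (hε : 0 < ε) (p : ℝ) :
    Continuous fun x : ℝ => (x ^ 2 + ε) ^ p :=
  Continuous.rpow_const (by fun_prop) fun x => Or.inl (by positivity)

theorem hasDerivAt_sGP {ε : ℝ} (hε : 0 < ε) (β ρ : ℝ) :
    HasDerivAt (sGP β ε) (β * (ρ ^ 2 + ε) ^ ((β - 1) / 2)) ρ :=
  (((continuous_sq_add_rpow hε _).integral_hasStrictDerivAt 0 ρ).hasDerivAt).const_mul β

theorem hasDerivAt_mul_sq_add_rpow {ε : ℝ} (hε : 0 < ε) (p x : ℝ) :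
    HasDerivAt (fun x : ℝ => x * (x ^ 2 + ε) ^ p)
      ((x ^ 2 + ε) ^ p * (1 + 2 * p * (x ^ 2 / (x ^ 2 + ε)))) x := by
  have hx : 0 < x ^ 2 + ε := by positivity
  have h := (hasDerivAt_id x).mul
    ((((hasDerivAt_id x).pow 2).add_const ε).rpow_const (p := p) (Or.inl hx.ne'))
  refine h.congr_deriv ?_
  simp only [id, Pi.pow_apply, Real.rpow_sub_one hx.ne']
  field_simp
  ring

/-- The arclength is at least the radius times the (decreasing) density at the endpoint. -/
theorem mul_rpow_le_sGP {β ε ρ : ℝ} (hβ : 0 < β) (hβ1 : β < 1) (hε : 0 < ε) (hρ : 0 < ρ) :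
    β * (ρ * (ρ ^ 2 + ε) ^ ((β - 1) / 2)) ≤ sGP β ε ρ := by
  refine mul_le_mul_of_nonneg_left ?_ hβ.le
  have h := intervalIntegral.integral_mono_on (μ := MeasureTheory.volume) hρ.le
    (continuous_const (y := (ρ ^ 2 + ε) ^ ((β - 1) / 2)) |>.intervalIntegrable 0 ρ)
    ((continuous_sq_add_rpow hε ((β - 1) / 2)).intervalIntegrable 0 ρ) fun x hx =>
      Real.rpow_le_rpow_of_nonpos (by positivity)
        (by gcongr; exacts [hx.1, hx.2]) (by linarith)
  simpa using h

/-- The arclength is smaller than the radius times the density at the endpoint,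
since `ρ (ρ²+ε)^{(β−1)/2}` grows faster than `s_ε`. -/
theorem sGP_lt_mul_rpow {β ε ρ : ℝ} (hβ1 : β < 1) (hε : 0 < ε) (hρ : 0 < ρ) :
    sGP β ε ρ < ρ * (ρ ^ 2 + ε) ^ ((β - 1) / 2) := by
  have hd (x : ℝ) := (hasDerivAt_mul_sq_add_rpow hε ((β - 1) / 2) x).sub (hasDerivAt_sGP hε β x)
  have hmono := strictMono_of_hasDerivAt_pos hd fun x => by
    have hx : 0 < x ^ 2 + ε := by positivity
    have hlt : x ^ 2 / (x ^ 2 + ε) < 1 := (div_lt_one hx).2 (by linarith)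
    have hp : 0 < (x ^ 2 + ε) ^ ((β - 1) / 2) := by positivity
    nlinarith [mul_pos hp (mul_pos (sub_pos.2 hβ1) (sub_pos.2 hlt))]
  have h := hmono hρ
  simp only [Pi.sub_apply, zero_mul, sGP, intervalIntegral.integral_same, mul_zero, sub_zero] at h
  exact sub_pos.1 h

theorem aGP_eq_sq {β ε : ℝ} (hε : 0 < ε) (ρ : ℝ) :
    aGP β ε ρ = (β * (ρ * (ρ ^ 2 + ε) ^ ((β - 1) / 2)) / sGP β ε ρ) ^ 2 := by
  have hx : 0 < ρ ^ 2 + ε := by positivity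
  have h : ((ρ ^ 2 + ε) ^ ((β - 1) / 2)) ^ 2 = ((ρ ^ 2 + ε) ^ (1 - β))⁻¹ := by
    rw [← Real.rpow_mul_natCast hx.le, ← Real.rpow_neg hx.le]
    congr 1
    push_cast
    ring
  rw [aGP, div_pow, mul_pow, mul_pow, h, div_mul_eq_div_div, ← mul_assoc, ← div_eq_mul_inv]

/-- Fix `β ∈ (0,1)` and `ε > 0`. Then `β² < a_ε(ρ) ≤ 1` for every `ρ > 0`:
in the canonical polar coordinates the perturbed cone metric
`β²(|z|²+ε)^{β−1}|dz|² = ds² + a_ε²s²dθ²` is uniformly (independently of `ε`)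
quasi-isometric to the Euclidean metric. -/
theorem aGP_bounds (β ε : ℝ) (hβ : 0 < β) (hβ1 : β < 1) (hε : 0 < ε) :
    ∀ ρ > (0:ℝ), β ^ 2 < aGP β ε ρ ∧ aGP β ε ρ ≤ 1 := by
  intro ρ hρ
  have hle := mul_rpow_le_sGP hβ hβ1 hε hρ
  have hlt := sGP_lt_mul_rpow hβ1 hε hρ
  have hs : 0 < sGP β ε ρ := lt_of_lt_of_le (by positivity) hle
  rw [aGP_eq_sq hε]
  refine ⟨?_, pow_le_one₀ (by positivity) ((div_le_one hs).2 hle)⟩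
  gcongr
  exact (lt_div_iff₀ hs).2 (mul_lt_mul_of_pos_left hlt hβ)
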